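/- For 3-periodic billiard orbits in the ellipse x²/a² + y²/b² = 1, the sum over the three vertices of the reciprocal distances from the focus f₁ = (−c, 0), i.e. Σᵢ 1/|Pᵢ − f₁|, is invariant and equals (a² + b² + δ)/(ab²), where δ = √(a⁴ − a²b² + b⁴). -/

import Mathlib

noncomputable section

namespace BilliardInv

/-- A point of the plane. -/
abbrev Pt := ℝ × ℝ

/-- Euclidean dot product. -/
def dot (p q : Pt) : ℝ := p.1 * q.1 + p.2 * q.2

/-- Euclidean distance. -/
def dst (p q : Pt) : ℝ := Real.sqrt ((p.1 - q.1) ^ 2 + (p.2 - q.2) ^ 2)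

/-- Membership in the ellipse x²/a² + y²/b² = 1. -/
def onEllipse (a b : ℝ) (p : Pt) : Prop := p.1 ^ 2 / a ^ 2 + p.2 ^ 2 / b ^ 2 = 1

/-- Half the gradient of f(x,y) = x²/a² + y²/b² (an outward normal direction). -/
def nrm (a b : ℝ) (p : Pt) : Pt := (p.1 / a ^ 2, p.2 / b ^ 2)

/-- Unit vector pointing from `v` toward `q`. -/
def udir (v q : Pt) : Pt := (dst v q)⁻¹ • (q - v)

/-- The billiard reflection law at vertex `v` with neighboring vertices `q`, `r`:
the two adjacent sides make equal angles with the ellipse normal at `v`. -/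
def reflectAt (a b : ℝ) (q v r : Pt) : Prop :=
  dot (udir v q) (nrm a b v) = dot (udir v r) (nrm a b v)

/-- A 3-periodic billiard orbit in the ellipse with semi-axes `a > b > 0`:
a nondegenerate triangle inscribed in the ellipse obeying the reflection
law at each vertex. -/
structure Orbit3 (a b : ℝ) : Type where
  P1 : Pt
  P2 : Pt
  P3 : Pt
  h1 : onEllipse a b P1
  h2 : onEllipse a b P2
  h3 : onEllipse a b P3
  d12 : P1 ≠ P2
  d23 : P2 ≠ P3
  d31 : P3 ≠ P1
  r1 : reflectAt a b P3 P1 P2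
  r2 : reflectAt a b P1 P2 P3
  r3 : reflectAt a b P2 P3 P1

/-- Inversion of `p` with respect to the circle of radius `ρ` centered at `f`. -/
def inva (ρ : ℝ) (f p : Pt) : Pt :=
  f + (ρ ^ 2 / ((p.1 - f.1) ^ 2 + (p.2 - f.2) ^ 2)) • (p - f)

/-- Unsigned area of a triangle. -/
def area (A B C : Pt) : ℝ :=
  |(B.1 - A.1) * (C.2 - A.2) - (B.2 - A.2) * (C.1 - A.1)| / 2

/-- The point with barycentric coordinates wA : wB : wC w.r.t. triangle ABC. -/
def bary (wA wB wC : ℝ) (A B C : Pt) : Pt :=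
  (wA + wB + wC)⁻¹ • (wA • A + wB • B + wC • C)

/-- Side length a = |BC|. -/
def sA (A B C : Pt) : ℝ := dst B C
/-- Side length b = |CA|. -/
def sB (A B C : Pt) : ℝ := dst C A
/-- Side length c = |AB|. -/
def sC (A B C : Pt) : ℝ := dst A B

/-- Incenter X(1). -/
def incenter (A B C : Pt) : Pt := bary (sA A B C) (sB A B C) (sC A B C) A B C

/-- Barycenter (centroid) X(2). -/
def centroid (A B C : Pt) : Pt := bary 1 1 1 A B C

/-- Circumcenter X(3), via its barycentric coordinates a²(b²+c²−a²) : · : ·. -/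
def circumcenter (A B C : Pt) : Pt :=
  bary (sA A B C ^ 2 * (sB A B C ^ 2 + sC A B C ^ 2 - sA A B C ^ 2))
       (sB A B C ^ 2 * (sC A B C ^ 2 + sA A B C ^ 2 - sB A B C ^ 2))
       (sC A B C ^ 2 * (sA A B C ^ 2 + sB A B C ^ 2 - sC A B C ^ 2)) A B C

/-- Orthocenter X(4) = A + B + C − 2·(circumcenter). -/
def orthocenter (A B C : Pt) : Pt := A + B + C - (2 : ℝ) • circumcenter A B C

/-- Nine-point center X(5): midpoint of circumcenter and orthocenter. -/
def ninePointCenter (A B C : Pt) : Pt :=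
  ((1 : ℝ) / 2) • (circumcenter A B C + orthocenter A B C)

/-- Gergonne point X(7), barycentrics 1/(b+c−a) : 1/(c+a−b) : 1/(a+b−c). -/
def gergonne (A B C : Pt) : Pt :=
  bary (sB A B C + sC A B C - sA A B C)⁻¹
       (sC A B C + sA A B C - sB A B C)⁻¹
       (sA A B C + sB A B C - sC A B C)⁻¹ A B C

/-- Mittenpunkt X(9), barycentrics a(b+c−a) : b(c+a−b) : c(a+b−c). -/
def mittenpunkt (A B C : Pt) : Pt :=
  bary (sA A B C * (sB A B C + sC A B C - sA A B C))
       (sB A B C * (sC A B C + sA A B C - sB A B C))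
       (sC A B C * (sA A B C + sB A B C - sC A B C)) A B C

/-- Feuerbach point X(11), barycentrics (b+c−a)(b−c)² : · : ·. -/
def feuerbach (A B C : Pt) : Pt :=
  bary ((sB A B C + sC A B C - sA A B C) * (sB A B C - sC A B C) ^ 2)
       ((sC A B C + sA A B C - sB A B C) * (sC A B C - sA A B C) ^ 2)
       ((sA A B C + sB A B C - sC A B C) * (sA A B C - sB A B C) ^ 2) A B C

/-- Triangle center X(100), barycentrics a/(b−c) : b/(c−a) : c/(a−b). -/
def X100 (A B C : Pt) : Pt :=
  bary (sA A B C / (sB A B C - sC A B C))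
       (sB A B C / (sC A B C - sA A B C))
       (sC A B C / (sA A B C - sB A B C)) A B C

/-- Orthogonal projection of `Q` onto the line through `A` and `B`. -/
def projLine (Q A B : Pt) : Pt :=
  A + (dot (Q - A) (B - A) / dot (B - A) (B - A)) • (B - A)

/-- Unsigned area of the pedal triangle of `Q` w.r.t. triangle `A B C`. -/
def pedalArea (Q A B C : Pt) : ℝ :=
  area (projLine Q A B) (projLine Q B C) (projLine Q C A)

end BilliardInv

open BilliardInv Real

/-- Algebraic core: three points of the unit circle, pairwise conjugate for a diagonal form. -/
lemma core_conj (A B C u1 v1 u2 v2 u3 v3 : ℝ) (h1 : u1 ^ 2 + v1 ^ 2 = 1)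
    (h2 : u2 ^ 2 + v2 ^ 2 = 1) (h3 : u3 ^ 2 + v3 ^ 2 = 1)
    (k12 : A * (u1 * u2) + B * (v1 * v2) = C) (k13 : A * (u1 * u3) + B * (v1 * v3) = C)
    (k23 : A * (u2 * u3) + B * (v2 * v3) = C)
    (hd : (u2 - u3) ^ 2 + (v2 - v3) ^ 2 ≠ 0) (hB : 0 < B) (hBA : A < B) (hCA : C < A) :
    A * B + B * C + C * A = 0 ∧
    B ^ 2 * (u1 * u2 + u1 * u3 + u2 * u3) = C ^ 2 - B ^ 2 ∧
    (A ^ 2 - B ^ 2) * (u1 * u2 * u3) = B ^ 2 * (u1 + u2 + u3) := by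
  have hN : A ^ 2 * u1 ^ 2 + B ^ 2 * v1 ^ 2 ≠ 0 := by
    intro h
    have e1 : A * u1 = 0 := by nlinarith [sq_nonneg (A * u1), sq_nonneg (B * v1)]
    have e2 : B * v1 = 0 := by nlinarith [sq_nonneg (A * u1), sq_nonneg (B * v1)]
    have e3 : v1 = 0 := by
      rcases mul_eq_zero.1 e2 with h | h
      · exact absurd h hB.ne'
      · exact h
    have e4 : C = 0 := by linear_combination -k12 + u2 * e1 + v2 * e2
    have e5 : A = 0 := by
      rcases mul_eq_zero.1 e1 with h | h
      · exact h
      · rw [h, e3] at h1; norm_num at h1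
    linarith
  obtain ⟨N, hNd⟩ : ∃ N, N = A ^ 2 * u1 ^ 2 + B ^ 2 * v1 ^ 2 := ⟨_, rfl⟩
  rw [← hNd] at hN
  -- perpendicularity
  have p1 : A * u1 * (u2 - u3) + B * v1 * (v2 - v3) = 0 := by linear_combination k12 - k13
  have p2 : (u2 + u3) * (u2 - u3) + (v2 + v3) * (v2 - v3) = 0 := by linear_combination h2 - h3
  have p3 : (u2 + u3) * (B * v1) - (v2 + v3) * (A * u1) = 0 := by
    have : ((u2 - u3) ^ 2 + (v2 - v3) ^ 2) *
      ((u2 + u3) * (B * v1) - (v2 + v3) * (A * u1)) = 0 := by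
      linear_combination ((u2 - u3) * (B * v1) - (v2 - v3) * (A * u1)) * p2
        + ((v2 - v3) * (u2 + u3) - (u2 - u3) * (v2 + v3)) * p1
    exact (mul_eq_zero.1 this).resolve_left hd
  have p4 : A * u1 * (u2 + u3) + B * v1 * (v2 + v3) = 2 * C := by linear_combination k12 + k13
  have su : N * (u2 + u3) = 2 * (A * C * u1) := by
    rw [hNd]; linear_combination A * u1 * p4 + B * v1 * p3
  have sv : N * (v2 + v3) = 2 * (B * C * v1) := by
    rw [hNd]; linear_combination B * v1 * p4 - A * u1 * p3
  have ss : N * ((u2 + u3) ^ 2 + (v2 + v3) ^ 2) = 4 * C ^ 2 := by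
    linear_combination (u2 + u3) * su + (v2 + v3) * sv + 2 * C * p4
  have dd : N * ((u2 - u3) ^ 2 + (v2 - v3) ^ 2) = 4 * N - 4 * C ^ 2 := by
    linear_combination 2 * N * h2 + 2 * N * h3 - ss
  have du : N * (u2 - u3) ^ 2 = B ^ 2 * v1 ^ 2 * ((u2 - u3) ^ 2 + (v2 - v3) ^ 2) := by
    rw [hNd]; linear_combination (A * u1 * (u2 - u3) - B * v1 * (v2 - v3)) * p1
  have dv : N * (v2 - v3) ^ 2 = A ^ 2 * u1 ^ 2 * ((u2 - u3) ^ 2 + (v2 - v3) ^ 2) := by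
    rw [hNd]; linear_combination (B * v1 * (v2 - v3) - A * u1 * (u2 - u3)) * p1
  have pu : N * (u2 * u3) = C ^ 2 - B ^ 2 * v1 ^ 2 := by
    apply mul_left_cancel₀ hN
    linear_combination (1/4) * (N * (u2 + u3) + 2 * (A * C * u1)) * su - (1/4) * N * du
      - (1/4) * B ^ 2 * v1 ^ 2 * dd - C ^ 2 * hNd
  have pv : N * (v2 * v3) = C ^ 2 - A ^ 2 * u1 ^ 2 := by
    apply mul_left_cancel₀ hN
    linear_combination (1/4) * (N * (v2 + v3) + 2 * (B * C * v1)) * sv - (1/4) * N * dv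
      - (1/4) * A ^ 2 * u1 ^ 2 * dd - C ^ 2 * hNd
  have hG : A * B + B * C + C * A = 0 := by
    have : (A * B + B * C + C * A) * ((C - A) - v1 ^ 2 * (B - A)) = 0 := by
      linear_combination N * k23 - A * pu - B * pv + C * hNd + (A ^ 2 * B + C * A ^ 2) * h1
    refine (mul_eq_zero.1 this).resolve_right ?_
    nlinarith [mul_nonneg (sq_nonneg v1) (sub_pos.2 hBA).le]
  refine ⟨hG, ?_, ?_⟩
  · apply mul_left_cancel₀ hN
    linear_combination B ^ 2 * (u1 * su + pu) + u1 ^ 2 * (B * (A + C) - A * C) * hG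
      - B ^ 2 * C ^ 2 * h1 - (C ^ 2 - B ^ 2) * hNd
  · apply mul_left_cancel₀ hN
    linear_combination (A ^ 2 - B ^ 2) * u1 * pu - B ^ 2 * su - B ^ 2 * u1 * hNd
      - u1 * (B * (A + C) - A * C) * hG - u1 * A ^ 2 * B ^ 2 * h1

/-- Normalised chord facts: positivity of length and of `1 - ⟨p, q⟩`. -/
lemma chord_pos {a b : ℝ} (ha : 0 < a) (hb : 0 < b) {p q : Pt} (hp : onEllipse a b p)
    (hq : onEllipse a b q) (h : p ≠ q) :
    0 < dst p q ∧ 0 < 1 - (p.1 / a * (q.1 / a) + p.2 / b * (q.2 / b)) ∧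
    0 < (p.1 / a - q.1 / a) ^ 2 + (p.2 / b - q.2 / b) ^ 2 := by
  have key : p.1 - q.1 ≠ 0 ∨ p.2 - q.2 ≠ 0 := by
    by_contra hc
    push Not at hc
    exact h (Prod.ext (sub_eq_zero.1 hc.1) (sub_eq_zero.1 hc.2))
  have h3 : 0 < (p.1 / a - q.1 / a) ^ 2 + (p.2 / b - q.2 / b) ^ 2 := by
    rw [← sub_div, ← sub_div]
    rcases key with k | k
    · have : (p.1 - q.1) / a ≠ 0 := div_ne_zero k ha.ne'
      positivity
    · have : (p.2 - q.2) / b ≠ 0 := div_ne_zero k hb.ne'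
      positivity
  refine ⟨?_, ?_, h3⟩
  · apply Real.sqrt_pos.2
    rcases key with k | k <;> positivity
  · unfold onEllipse at hp hq
    rw [← div_pow, ← div_pow] at hp hq
    nlinarith

lemma dst_comm' (p q : Pt) : dst p q = dst q p := by
  unfold dst; congr 1; ring

lemma dst_sq (p q : Pt) : dst p q ^ 2 = (p.1 - q.1) ^ 2 + (p.2 - q.2) ^ 2 := by
  unfold dst; exact Real.sq_sqrt (by positivity)

/-- The normal component of a unit chord direction. -/
lemma dot_udir {a b : ℝ} (ha : 0 < a) (hb : 0 < b) {v : Pt} (q : Pt) (hv : onEllipse a b v) :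
    dot (udir v q) (nrm a b v) =
      -((1 - (v.1 / a * (q.1 / a) + v.2 / b * (q.2 / b))) / dst v q) := by
  unfold onEllipse at hv
  simp only [dot, udir, nrm, Prod.smul_fst, Prod.smul_snd, Prod.fst_sub, Prod.snd_sub,
    smul_eq_mul]
  rw [div_eq_mul_inv _ (dst v q)]
  have : (v.1 / a * (q.1 / a) + v.2 / b * (q.2 / b)) =
    q.1 * (v.1 / a ^ 2) + q.2 * (v.2 / b ^ 2) := by field_simp
  rw [this]
  linear_combination -(dst v q)⁻¹ * hv

/-- Each chord yields a conjugacy relation. -/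
lemma chord_rel {a b s : ℝ} (ha : 0 < a) (hb : 0 < b) {p q : Pt} (hp : onEllipse a b p)
    (hq : onEllipse a b q) (h : p ≠ q)
    (hk : (1 - (p.1 / a * (q.1 / a) + p.2 / b * (q.2 / b))) ^ 2 = s * dst p q ^ 2) :
    (1 - s * (a ^ 2 - b ^ 2)) * (p.1 / a * (q.1 / a)) +
      (1 + s * (a ^ 2 - b ^ 2)) * (p.2 / b * (q.2 / b)) = 1 - s * (a ^ 2 + b ^ 2) := by
  obtain ⟨-, h2, -⟩ := chord_pos ha hb hp hq h
  rw [dst_sq] at hk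
  unfold onEllipse at hp hq
  rw [← div_pow, ← div_pow] at hp hq
  have ep : p.1 - q.1 = a * (p.1 / a - q.1 / a) := by field_simp
  have eq : p.2 - q.2 = b * (p.2 / b - q.2 / b) := by field_simp
  rw [ep, eq] at hk
  generalize p.1 / a = x at *
  generalize p.2 / b = y at *
  generalize q.1 / a = z at *
  generalize q.2 / b = w at *
  apply mul_left_cancel₀ h2.ne'
  -- (x-z)^2 = k (1 - (xz - yw)), (y-w)^2 = k (1 + (xz - yw)), with k = 1 - xz - yw
  have i1 : (x - z) ^ 2 = (1 - (x * z + y * w)) * (1 - (x * z - y * w)) := by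
    linear_combination (1 - z ^ 2) * hp + y ^ 2 * hq
  have i2 : (y - w) ^ 2 = (1 - (x * z + y * w)) * (1 + (x * z - y * w)) := by
    linear_combination (1 - w ^ 2) * hp + x ^ 2 * hq
  linear_combination -hk - s * a ^ 2 * i1 - s * b ^ 2 * i2

/-- Focal distance formula. -/
lemma focal {a b : ℝ} (hab : a > b) (hb : b > 0) {p : Pt} (hp : onEllipse a b p) :
    dst p (-Real.sqrt (a ^ 2 - b ^ 2), 0) = a + Real.sqrt (a ^ 2 - b ^ 2) * (p.1 / a) ∧
    0 < a + Real.sqrt (a ^ 2 - b ^ 2) * (p.1 / a) := by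
  have ha : 0 < a := hb.trans hab
  have hc : Real.sqrt (a ^ 2 - b ^ 2) ^ 2 = a ^ 2 - b ^ 2 := Real.sq_sqrt (by nlinarith)
  have hc0 := Real.sqrt_nonneg (a ^ 2 - b ^ 2)
  generalize Real.sqrt (a ^ 2 - b ^ 2) = c at *
  have hca : c < a := by nlinarith
  unfold onEllipse at hp
  rw [← div_pow, ← div_pow] at hp
  have ex : p.1 = a * (p.1 / a) := by field_simp
  have ey : p.2 = b * (p.2 / b) := by field_simp
  have hu : -1 ≤ p.1 / a := by nlinarith [sq_nonneg (p.2 / b)]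
  have hpos : 0 < a + c * (p.1 / a) := by nlinarith
  refine ⟨?_, hpos⟩
  unfold dst
  rw [← Real.sqrt_sq hpos.le]
  congr 1
  simp only
  generalize p.1 / a = x at *
  generalize p.2 / b = y at *
  rw [ex, ey]
  linear_combination b ^ 2 * hp + (1 - x ^ 2) * hc

/-- the sum of reciprocal focal distances Σᵢ 1/|Pᵢ − f₁| is
invariant over the 3-periodic billiard family and equals (a² + b² + δ)/(ab²). -/
theorem sum_reciprocal_focal_distances (a b : ℝ) (hab : a > b) (hb : b > 0)
    (T : Orbit3 a b) :
    let δ : ℝ := Real.sqrt (a ^ 4 - a ^ 2 * b ^ 2 + b ^ 4)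
    let f1 : Pt := (-Real.sqrt (a ^ 2 - b ^ 2), 0)
    1 / dst T.P1 f1 + 1 / dst T.P2 f1 + 1 / dst T.P3 f1 =
      (a ^ 2 + b ^ 2 + δ) / (a * b ^ 2) := by
  intro δ f1
  have ha : 0 < a := hb.trans hab
  obtain ⟨P1, P2, P3, h1, h2, h3, d12, d23, d31, r1, r2, r3⟩ := T
  obtain ⟨f1e, f1p⟩ := focal hab hb h1
  obtain ⟨f2e, f2p⟩ := focal hab hb h2
  obtain ⟨f3e, f3p⟩ := focal hab hb h3
  show 1 / dst P1 (-Real.sqrt (a ^ 2 - b ^ 2), 0) + 1 / dst P2 (-Real.sqrt (a ^ 2 - b ^ 2), 0)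
    + 1 / dst P3 (-Real.sqrt (a ^ 2 - b ^ 2), 0) = _
  rw [f1e, f2e, f3e]
  clear f1e f2e f3e f1
  have hδ : δ ^ 2 = a ^ 4 - a ^ 2 * b ^ 2 + b ^ 4 :=
    Real.sq_sqrt (by nlinarith [sq_nonneg (a ^ 2 - b ^ 2), sq_nonneg (a * b)])
  have hδ0 : 0 ≤ δ := Real.sqrt_nonneg _
  clear_value δ
  have hcc : 0 < a ^ 2 - b ^ 2 := by nlinarith
  have hc : Real.sqrt (a ^ 2 - b ^ 2) ^ 2 = a ^ 2 - b ^ 2 := Real.sq_sqrt hcc.le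
  generalize Real.sqrt (a ^ 2 - b ^ 2) = c at *
  obtain ⟨l12, m12, -⟩ := chord_pos ha hb h1 h2 d12
  obtain ⟨l23, m23, n23⟩ := chord_pos ha hb h2 h3 d23
  obtain ⟨l13, m13, -⟩ := chord_pos ha hb h1 h3 d31.symm
  have q1 : (1 - (P1.1 / a * (P3.1 / a) + P1.2 / b * (P3.2 / b))) / dst P1 P3 =
      (1 - (P1.1 / a * (P2.1 / a) + P1.2 / b * (P2.2 / b))) / dst P1 P2 := by
    unfold reflectAt at r1
    rw [dot_udir ha hb _ h1, dot_udir ha hb _ h1] at r1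
    exact neg_injective r1
  have q2 : (1 - (P2.1 / a * (P3.1 / a) + P2.2 / b * (P3.2 / b))) / dst P2 P3 =
      (1 - (P1.1 / a * (P2.1 / a) + P1.2 / b * (P2.2 / b))) / dst P1 P2 := by
    unfold reflectAt at r2
    rw [dot_udir ha hb _ h2, dot_udir ha hb _ h2, dst_comm' P2 P1,
      mul_comm (P2.1 / a) (P1.1 / a), mul_comm (P2.2 / b) (P1.2 / b)] at r2
    exact (neg_injective r2).symm
  obtain ⟨J, hJ⟩ : ∃ J, J = (1 - (P1.1 / a * (P2.1 / a) + P1.2 / b * (P2.2 / b))) / dst P1 P2 :=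
    ⟨_, rfl⟩
  have hJ0 : 0 < J := hJ ▸ div_pos m12 l12
  rw [← hJ, div_eq_iff l13.ne'] at q1
  rw [← hJ, div_eq_iff l23.ne'] at q2
  rw [eq_div_iff l12.ne'] at hJ
  have k12 := chord_rel (s := J ^ 2) ha hb h1 h2 d12 (by rw [← hJ]; ring)
  have k13 := chord_rel (s := J ^ 2) ha hb h1 h3 d31.symm (by rw [q1]; ring)
  have k23 := chord_rel (s := J ^ 2) ha hb h2 h3 d23 (by rw [q2]; ring)
  have hs : 0 < J ^ 2 := by positivity
  generalize J ^ 2 = s at *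
  unfold onEllipse at h1 h2 h3
  rw [← div_pow, ← div_pow] at h1 h2 h3
  have hsc : 0 < s * (a ^ 2 - b ^ 2) := mul_pos hs hcc
  have hsb : 0 < s * b ^ 2 := by positivity
  obtain ⟨g1, g2, g3⟩ := core_conj _ _ _ _ _ _ _ _ _ h1 h2 h3 k12 k13 k23 n23.ne'
    (by linarith) (by linarith) (by linarith)
  generalize P1.1 / a = x at *
  generalize P2.1 / a = y at *
  generalize P3.1 / a = z at *
  clear k12 k13 k23 h1 h2 h3 m12 m13 m23 n23
  -- quadratic for s
  have hq : s ^ 2 * (a ^ 2 - b ^ 2) ^ 2 = 3 - 2 * (a ^ 2 + b ^ 2) * s := by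
    linear_combination -g1
  have hsd : s * (a ^ 2 - b ^ 2) ^ 2 = 2 * δ - (a ^ 2 + b ^ 2) := by
    have e : (s * (a ^ 2 - b ^ 2) ^ 2 + (a ^ 2 + b ^ 2) - 2 * δ) *
        (s * (a ^ 2 - b ^ 2) ^ 2 + (a ^ 2 + b ^ 2) + 2 * δ) = 0 := by
      linear_combination (a ^ 2 - b ^ 2) ^ 2 * hq - 4 * hδ
    have e2 : 0 < s * (a ^ 2 - b ^ 2) ^ 2 + (a ^ 2 + b ^ 2) + 2 * δ := by positivity
    linarith [(mul_eq_zero.1 e).resolve_right e2.ne']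
  have hB2 : (1 + s * (a ^ 2 - b ^ 2)) ^ 2 = 4 * (1 - s * b ^ 2) := by
    linear_combination hq
  have hB0 : (1 + s * (a ^ 2 - b ^ 2)) ^ 2 ≠ 0 := by positivity
  have e2 : x * y + x * z + y * z = -(s * a ^ 2) := by
    apply mul_left_cancel₀ hB0
    linear_combination g2 + s * a ^ 2 * hB2
  have e3 : s * c ^ 2 * (x * y * z) = -((1 - s * b ^ 2) * (x + y + z)) := by
    linear_combination (-1 / 4) * g3 - (1 / 4) * (x + y + z) * hB2 + s * (x * y * z) * hc
  have j1 : 2 * a ^ 2 * b ^ 2 * s = (a ^ 2 + b ^ 2 + δ) * ((a ^ 2 + b ^ 2) * s - 1) := by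
    apply mul_left_cancel₀ (pow_pos hcc 2).ne'
    linear_combination (2 * a ^ 2 * b ^ 2 - (a ^ 2 + b ^ 2 + δ) * (a ^ 2 + b ^ 2)) * hsd
      - 2 * (a ^ 2 + b ^ 2) * hδ
  have j2 : (3 - s * (a ^ 2 - b ^ 2)) * b ^ 2
      = (a ^ 2 + b ^ 2 + δ) * (1 - s * (a ^ 2 - b ^ 2)) := by
    apply mul_left_cancel₀ hcc.ne'
    linear_combination (-b ^ 2 + (a ^ 2 + b ^ 2 + δ)) * hsd + 2 * hδ
  have hsum : 1 / (a + c * x) + 1 / (a + c * y) + 1 / (a + c * z) =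
      ((a + c * y) * (a + c * z) + (a + c * x) * (a + c * z) + (a + c * x) * (a + c * y)) /
        ((a + c * x) * (a + c * y) * (a + c * z)) := by
    field_simp
  rw [hsum, div_eq_div_iff (by positivity) (by positivity)]
  apply mul_left_cancel₀ hs.ne'
  linear_combination a ^ 3 * s * j2 + c * (x + y + z) * j1
    + (s * c ^ 2 * a * b ^ 2 - (a ^ 2 + b ^ 2 + δ) * s * a * c ^ 2) * e2
    - (a ^ 2 + b ^ 2 + δ) * c * e3
    + (-(s * a * b ^ 2 * (s * a ^ 2)) + (a ^ 2 + b ^ 2 + δ) * s * a * (s * a ^ 2)) * hc
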